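/- Let K be an origin-symmetric convex body in ℝⁿ, and let μ be the measure with density e^{−V}, where V : ℝⁿ → ℝ is an even convex C² function, such that ∫_K ΔV dμ ≤ k₂ n μ(K) for some k₂ ≥ 0. Let C = C_poin(K, μ) be the Poincaré constant of μ restricted to K, assumed finite and positive. Let u be an even C² function on K satisfying Lu = 1 on K, where Lu = Δu − ⟨∇u, ∇V⟩, and let a, b ∈ ℝ satisfy a·C^{−2} + b ≥ 0 and a ≥ b. Then (1/μ(K)) ∫_K ( a·‖∇²u‖² + b·|∇u|² ) dμ ≥ (a·C^{−2} + b) / ( (1 + C^{−2})(1 + k₂)·n ). -/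

import Mathlib

open MeasureTheory
open scoped RealInnerProductSpace ENNReal

noncomputable section

abbrev Euc (n : ℕ) : Type := EuclideanSpace ℝ (Fin n)

/-- A convex body: a compact convex set with nonempty interior. -/
def IsConvexBody {n : ℕ} (K : Set (Euc n)) : Prop :=
  IsCompact K ∧ Convex ℝ K ∧ (interior K).Nonempty

/-- The support function `h_K(u) = sup_{y ∈ K} ⟨u, y⟩`. -/
def suppFn {n : ℕ} (K : Set (Euc n)) (u : Euc n) : ℝ :=
  sSup ((fun y => ⟪u, y⟫) '' K)

/-- `lpComb p lam K L` is the `L_p` combination `lam·K +_p (1−lam)·L`;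
for `p = 0` it is the logarithmic combination. -/
def lpComb {n : ℕ} (p lam : ℝ) (K L : Set (Euc n)) : Set (Euc n) :=
  if p = 0 then
    {x | ∀ u : Euc n, ‖u‖ = 1 → ⟪x, u⟫ ≤ suppFn K u ^ lam * suppFn L u ^ (1 - lam)}
  else
    {x | ∀ u : Euc n, ‖u‖ = 1 →
      ⟪x, u⟫ ≤ (lam * suppFn K u ^ p + (1 - lam) * suppFn L u ^ p) ^ (1 / p)}


/-- The Laplacian `Δ V` of a function on `ℝⁿ`, as the trace of its Hessian. -/
def lapl {n : ℕ} (V : Euc n → ℝ) (x : Euc n) : ℝ :=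
  ∑ i : Fin n,
    iteratedFDeriv ℝ 2 V x ![EuclideanSpace.single i 1, EuclideanSpace.single i 1]

/-- The squared Hilbert–Schmidt (Frobenius) norm `‖∇²u‖²` of the Hessian. -/
def hessHS2 {n : ℕ} (u : Euc n → ℝ) (x : Euc n) : ℝ :=
  ∑ i : Fin n, ∑ j : Fin n,
    (iteratedFDeriv ℝ 2 u x ![EuclideanSpace.single i 1, EuclideanSpace.single j 1]) ^ 2

/-- The Poincaré inequality for `μ` restricted to `K` with constant `C`. -/
def PoincareHolds {n : ℕ} (μ : Measure (Euc n)) (K : Set (Euc n)) (C : ℝ) : Prop :=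
  ∀ f : Euc n → ℝ, ContDiff ℝ 1 f →
    (μ K).toReal⁻¹ * ∫ x in K, (f x) ^ 2 ∂μ
        - ((μ K).toReal⁻¹ * ∫ x in K, f x ∂μ) ^ 2
      ≤ C ^ 2 * ((μ K).toReal⁻¹ * ∫ x in K, ‖gradient f x‖ ^ 2 ∂μ)


lemma volume_add_le_of_isCompact {A B S : Set ℝ} (hA : IsCompact A) (hB : IsCompact B)
    (hA0 : A.Nonempty) (hB0 : B.Nonempty) (hS : ∀ x ∈ A, ∀ y ∈ B, (x + y) / 2 ∈ S) :
    volume A + volume B ≤ 2 * volume S := by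
  obtain ⟨p, hpA, hp⟩ := hA.exists_isGreatest hA0
  obtain ⟨q, hqB, hq⟩ := hB.exists_isLeast hB0
  have hsub : (fun x => x + q) '' A ∪ (fun y => y + p) '' B ⊆ (fun x => (2 : ℝ) • x) '' S := by
    rintro z (⟨x, hx, rfl⟩ | ⟨y, hy, rfl⟩)
    · exact ⟨_, hS x hx q hqB, by simp; ring⟩
    · exact ⟨_, hS p hpA y hy, by simp; ring⟩
  have hdis : AEDisjoint volume ((fun x => x + q) '' A) ((fun y => y + p) '' B) := by
    refine measure_mono_null (t := {p + q}) ?_ (by simp)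
    rintro z ⟨⟨x, hx, rfl⟩, ⟨y, hy, hxy⟩⟩
    have h1 := hp hx
    have h2 := hq hy
    simp only [Set.mem_singleton_iff] at *
    linarith
  have hBm : MeasurableSet ((fun y => y + p) '' B) :=
    (hB.image (by fun_prop)).measurableSet
  calc volume A + volume B
      = volume ((fun x => x + q) '' A) + volume ((fun y => y + p) '' B) := by simp
    _ = volume ((fun x => x + q) '' A ∪ (fun y => y + p) '' B) :=
        (measure_union₀ hBm.nullMeasurableSet hdis).symm
    _ ≤ volume ((fun x => (2 : ℝ) • x) '' S) := measure_mono hsub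
    _ = 2 * volume S := by
        have := Measure.addHaar_smul (volume : Measure ℝ) 2 S
        simpa only [Set.image_smul, Module.finrank_self, pow_one, abs_two, ENNReal.ofReal_ofNat] using this

/-- The one-dimensional Brunn–Minkowski inequality for midpoints. -/
lemma volume_add_le_of_midpoint {A B S : Set ℝ} (hA : MeasurableSet A) (hB : MeasurableSet B)
    (hA0 : A.Nonempty) (hB0 : B.Nonempty) (hS : ∀ x ∈ A, ∀ y ∈ B, (x + y) / 2 ∈ S) :
    volume A + volume B ≤ 2 * volume S := by
  rw [hA.measure_eq_iSup_isCompact, hB.measure_eq_iSup_isCompact]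
  obtain ⟨a, ha⟩ := hA0
  obtain ⟨b, hb⟩ := hB0
  simp only [iSup_and']
  refine ENNReal.biSup_add_biSup_le' ⟨∅, by simp⟩ ⟨∅, by simp⟩ ?_
  rintro A' ⟨hA', hA'c⟩ B' ⟨hB', hB'c⟩
  refine (add_le_add (measure_mono (Set.subset_insert a A'))
    (measure_mono (Set.subset_insert b B'))).trans
    (volume_add_le_of_isCompact (hA'c.insert a) (hB'c.insert b) (by simp) (by simp) ?_)
  intro x hx y hy
  exact hS x (Set.insert_subset ha hA' hx) y (Set.insert_subset hb hB' hy)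

lemma lintegral_ofReal_add_le {f g h : ℝ → ℝ} (hf : Measurable f) (hg : Measurable g)
    (hh : Measurable h) (hf0 : ∀ x, 0 ≤ f x) (hg0 : ∀ x, 0 ≤ g x) (hh0 : ∀ x, 0 ≤ h x)
    (hf1 : ∀ x, f x ≤ 1) (hg1 : ∀ x, g x ≤ 1)
    (hfs : ∀ t < 1, ∃ x, t < f x) (hgs : ∀ t < 1, ∃ x, t < g x)
    (H : ∀ t x y, 0 < t → t < f x → t < g y → t < h ((x + y) / 2)) :
    (∫⁻ x, ENNReal.ofReal (f x)) + ∫⁻ x, ENNReal.ofReal (g x)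
      ≤ 2 * ∫⁻ x, ENNReal.ofReal (h x) := by
  have meas : ∀ {k : ℝ → ℝ}, Measurable fun t => volume {x | t < k x} := fun {k} =>
    Antitone.measurable fun s t hst => measure_mono fun x hx => lt_of_le_of_lt hst hx
  rw [lintegral_eq_lintegral_meas_lt _ (.of_forall hf0) hf.aemeasurable,
    lintegral_eq_lintegral_meas_lt _ (.of_forall hg0) hg.aemeasurable,
    lintegral_eq_lintegral_meas_lt _ (.of_forall hh0) hh.aemeasurable,
    ← lintegral_add_left meas, ← lintegral_const_mul _ meas]
  refine setLIntegral_mono (meas.const_mul _) fun t ht => ?_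
  rcases lt_or_ge t 1 with h1 | h1
  · exact volume_add_le_of_midpoint (measurableSet_lt measurable_const hf)
      (measurableSet_lt measurable_const hg) (hfs t h1) (hgs t h1)
      fun x hx y hy => H t x y ht hx hy
  · have e1 : {x | t < f x} = ∅ := Set.eq_empty_of_forall_notMem fun x hx =>
      absurd (lt_of_le_of_lt h1 hx) (hf1 x).not_gt
    have e2 : {x | t < g x} = ∅ := Set.eq_empty_of_forall_notMem fun x hx =>
      absurd (lt_of_le_of_lt h1 hx) (hg1 x).not_gt
    simp [e1, e2]

lemma ENNReal.mul_le_sq_of_add_le_two_mul {a b c : ℝ≥0∞} (h : a + b ≤ 2 * c) :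
    a * b ≤ c ^ 2 := by
  rcases eq_or_ne c ⊤ with rfl | hc
  · simp
  have hab : a + b ≠ ⊤ := ne_top_of_le_ne_top (ENNReal.mul_ne_top (by simp) hc) h
  obtain ⟨ha, hb⟩ := ENNReal.add_ne_top.1 hab
  lift a to NNReal using ha
  lift b to NNReal using hb
  lift c to NNReal using hc
  norm_cast at h ⊢
  rw [← NNReal.coe_le_coe] at h ⊢
  push_cast at h ⊢
  have := a.coe_nonneg
  have := b.coe_nonneg
  nlinarith [sq_nonneg ((a : ℝ) - b)]

lemma exists_lt_toReal_mul_inv_iSup {f : ℝ → ℝ≥0∞} (h0 : ⨆ x, f x ≠ 0) (ht : ⨆ x, f x ≠ ⊤)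
    (t : ℝ) (h1 : t < 1) : ∃ x, t < (f x * (⨆ x, f x)⁻¹).toReal := by
  by_contra! hcon
  rcases lt_or_ge t 0 with h2 | h2
  · exact absurd (hcon 0) (not_le.2 (h2.trans_le ENNReal.toReal_nonneg))
  have key : ⨆ x, f x ≤ ENNReal.ofReal t * ⨆ x, f x := by
    refine iSup_le fun x => ?_
    have hne : f x * (⨆ x, f x)⁻¹ ≠ ⊤ :=
      ENNReal.mul_ne_top (ne_top_of_le_ne_top ht (le_iSup f x)) (by simpa using h0)
    have := (ENNReal.le_ofReal_iff_toReal_le hne h2).2 (hcon x)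
    rwa [← div_eq_mul_inv, ENNReal.div_le_iff h0 ht] at this
  have h3 : ENNReal.ofReal t < 1 := by simpa using h1
  have := ENNReal.mul_lt_mul_left h0 ht h3
  rw [one_mul] at this
  exact absurd key this.not_ge

lemma lintegral_mul_le_sq_of_bounded {f g h : ℝ → ℝ≥0∞} (hf : Measurable f) (hg : Measurable g)
    (hh : Measurable h) (hft : ⨆ x, f x ≠ ⊤) (hgt : ⨆ x, g x ≠ ⊤)
    (H : ∀ x y, f x * g y ≤ h ((x + y) / 2) ^ 2) :
    (∫⁻ x, f x) * ∫⁻ x, g x ≤ (∫⁻ x, h x) ^ 2 := by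
  rcases eq_or_ne (⨆ x, f x) 0 with ha | ha
  · have : ∀ x, f x = 0 := by simpa using ha
    simp [this]
  rcases eq_or_ne (⨆ x, g x) 0 with hb | hb
  · have : ∀ x, g x = 0 := by simpa using hb
    simp [this]
  have hfs := exists_lt_toReal_mul_inv_iSup ha hft
  have hgs := exists_lt_toReal_mul_inv_iSup hb hgt
  have hfle : ∀ x, f x ≤ ⨆ x, f x := le_iSup f
  have hgle : ∀ x, g x ≤ ⨆ x, g x := le_iSup g
  set a := ⨆ x, f x
  set b := ⨆ x, g x
  obtain ⟨c, hc⟩ : ∃ c : ℝ≥0∞, c ^ 2 = a * b :=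
    ⟨(a * b) ^ (1 / 2 : ℝ), by rw [← ENNReal.rpow_natCast, ← ENNReal.rpow_mul]; simp⟩
  have hc0 : c ≠ 0 := by
    rintro rfl
    rw [zero_pow two_ne_zero] at hc
    exact mul_ne_zero ha hb hc.symm
  have hct : c ≠ ⊤ := by
    rintro rfl
    rw [ENNReal.top_pow two_ne_zero] at hc
    exact ENNReal.mul_ne_top hft hgt hc.symm
  have hf1 : ∀ x, f x * a⁻¹ ≤ 1 := fun x => by
    rw [← div_eq_mul_inv, ENNReal.div_le_iff ha hft, one_mul]; exact hfle x
  have hg1 : ∀ x, g x * b⁻¹ ≤ 1 := fun x => by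
    rw [← div_eq_mul_inv, ENNReal.div_le_iff hb hgt, one_mul]; exact hgle x
  have key := lintegral_ofReal_add_le (f := fun x => (f x * a⁻¹).toReal)
    (g := fun x => (g x * b⁻¹).toReal) (h := fun x => (min (h x * c⁻¹) 1).toReal)
    (by fun_prop) (by fun_prop) (by fun_prop) (fun _ => ENNReal.toReal_nonneg)
    (fun _ => ENNReal.toReal_nonneg) (fun _ => ENNReal.toReal_nonneg)
    (fun x => ENNReal.toReal_le_of_le_ofReal zero_le_one (by simpa using hf1 x))
    (fun x => ENNReal.toReal_le_of_le_ofReal zero_le_one (by simpa using hg1 x))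
    hfs hgs (by
      intro t x y ht h1 h2
      have ne1 := ne_top_of_le_ne_top ENNReal.one_ne_top (hf1 x)
      have ne2 := ne_top_of_le_ne_top ENNReal.one_ne_top (hg1 y)
      rw [← ENNReal.ofReal_lt_iff_lt_toReal ht.le ne1] at h1
      rw [← ENNReal.ofReal_lt_iff_lt_toReal ht.le ne2] at h2
      rw [← ENNReal.ofReal_lt_iff_lt_toReal ht.le (by simp)]
      refine lt_min (lt_of_not_ge fun hle => (pow_le_pow_left' hle 2).not_gt ?_)
        (h1.trans_le (hf1 x))
      calc ENNReal.ofReal t ^ 2 = ENNReal.ofReal t * ENNReal.ofReal t := sq _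
        _ < (f x * a⁻¹) * (g y * b⁻¹) := ENNReal.mul_lt_mul h1 h2
        _ = (f x * g y) * (a⁻¹ * b⁻¹) := by ring
        _ = (f x * g y) * (c⁻¹) ^ 2 := by
            rw [← ENNReal.inv_pow, hc, ENNReal.mul_inv (.inl ha) (.inl hft)]
        _ ≤ h ((x + y) / 2) ^ 2 * (c⁻¹) ^ 2 := by gcongr; exact H x y
        _ = _ := by ring)
  have ef : ∀ x, ENNReal.ofReal (f x * a⁻¹).toReal = f x * a⁻¹ := fun x =>
    ENNReal.ofReal_toReal (ne_top_of_le_ne_top ENNReal.one_ne_top (hf1 x))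
  have eg : ∀ x, ENNReal.ofReal (g x * b⁻¹).toReal = g x * b⁻¹ := fun x =>
    ENNReal.ofReal_toReal (ne_top_of_le_ne_top ENNReal.one_ne_top (hg1 x))
  have eh : ∀ x, ENNReal.ofReal (min (h x * c⁻¹) 1).toReal = min (h x * c⁻¹) 1 := fun x =>
    ENNReal.ofReal_toReal (by simp)
  simp only [ef, eg, eh] at key
  have key2 := ENNReal.mul_le_sq_of_add_le_two_mul (key.trans (mul_le_mul_right
    (lintegral_mono fun x => min_le_left (h x * c⁻¹) 1) 2))
  rw [lintegral_mul_const _ hf, lintegral_mul_const _ hg, lintegral_mul_const _ hh] at key2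
  calc (∫⁻ x, f x) * ∫⁻ x, g x
      = (a * b) * (((∫⁻ x, f x) * a⁻¹) * ((∫⁻ x, g x) * b⁻¹)) := by
        rw [show (a * b) * (((∫⁻ x, f x) * a⁻¹) * ((∫⁻ x, g x) * b⁻¹))
          = (a * a⁻¹) * (b * b⁻¹) * ((∫⁻ x, f x) * ∫⁻ x, g x) by ring,
          ENNReal.mul_inv_cancel ha hft, ENNReal.mul_inv_cancel hb hgt, one_mul, one_mul]
    _ ≤ c ^ 2 * ((∫⁻ x, h x) * c⁻¹) ^ 2 := by rw [hc]; gcongr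
    _ = (c * c⁻¹) ^ 2 * (∫⁻ x, h x) ^ 2 := by ring
    _ = (∫⁻ x, h x) ^ 2 := by rw [ENNReal.mul_inv_cancel hc0 hct, one_pow, one_mul]

lemma lintegral_eq_iSup_lintegral_min {f : ℝ → ℝ≥0∞} (hf : Measurable f) :
    ∫⁻ x, f x = ⨆ n : ℕ, ∫⁻ x, min (f x) n := by
  rw [← lintegral_iSup (f := fun (n : ℕ) x => min (f x) n) (fun n => by fun_prop)
    (fun m n hmn x => min_le_min_left _ (by exact_mod_cast hmn))]
  congr with x
  rw [← inf_iSup_eq (f x), ENNReal.iSup_natCast, inf_top_eq]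

/-- The one-dimensional Prékopa–Leindler inequality for midpoints. -/
lemma prekopaLeindler_real {f g h : ℝ → ℝ≥0∞} (hf : Measurable f) (hg : Measurable g)
    (hh : Measurable h) (H : ∀ x y, f x * g y ≤ h ((x + y) / 2) ^ 2) :
    (∫⁻ x, f x) * ∫⁻ x, g x ≤ (∫⁻ x, h x) ^ 2 := by
  rw [lintegral_eq_iSup_lintegral_min hf, lintegral_eq_iSup_lintegral_min hg, ENNReal.iSup_mul]
  refine iSup_le fun m => ?_
  rw [ENNReal.mul_iSup]
  refine iSup_le fun n => ?_
  have hb : ∀ (k : ℝ → ℝ≥0∞) (n : ℕ), ⨆ x, min (k x) (n : ℝ≥0∞) ≠ ⊤ := fun k n =>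
    ne_top_of_le_ne_top (ENNReal.natCast_ne_top n) (iSup_le fun x => min_le_right _ _)
  exact lintegral_mul_le_sq_of_bounded (by fun_prop) (by fun_prop) hh (hb f m) (hb g n)
    fun x y => (mul_le_mul' (min_le_left _ _) (min_le_left _ _)).trans (H x y)

/-- The Prékopa–Leindler inequality for midpoints in `ℝⁿ`. -/
theorem prekopaLeindler_pi : ∀ {n : ℕ} {f g h : (Fin n → ℝ) → ℝ≥0∞}, Measurable f → Measurable g →
    Measurable h → (∀ x y, f x * g y ≤ h ((1 / 2 : ℝ) • (x + y)) ^ 2) →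
    (∫⁻ x, f x) * ∫⁻ x, g x ≤ (∫⁻ x, h x) ^ 2
  | 0, f, g, h, hf, hg, hh, H => by
    have := H default default
    rw [Measure.volume_pi_eq_dirac default, lintegral_dirac, lintegral_dirac, lintegral_dirac]
    convert this
  | n + 1, f, g, h, hf, hg, hh, H => by
    have mp := (volume_preserving_piFinSuccAbove (fun _ : Fin (n + 1) => ℝ) 0).symm
    have split : ∀ {k : (Fin (n + 1) → ℝ) → ℝ≥0∞}, Measurable k →
        ∫⁻ x, k x = ∫⁻ t : ℝ, ∫⁻ y : Fin n → ℝ, k (Fin.cons t y) := by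
      intro k hk
      rw [← mp.lintegral_comp hk, Measure.volume_eq_prod,
        lintegral_prod (fun p => k _) (hk.comp mp.measurable).aemeasurable]
      simp [Fin.insertNthEquiv]
    have hcons : Measurable fun p : ℝ × (Fin n → ℝ) => (Fin.cons p.1 p.2 : Fin (n + 1) → ℝ) := by
      simpa [MeasurableEquiv.piFinSuccAbove, Fin.insertNthEquiv] using mp.measurable
    have meas : ∀ {k : (Fin (n + 1) → ℝ) → ℝ≥0∞}, Measurable k →
        Measurable fun t : ℝ => ∫⁻ y : Fin n → ℝ, k (Fin.cons t y) := fun hk =>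
      (hk.comp hcons).lintegral_prod_right'
    have fib : ∀ {k : (Fin (n + 1) → ℝ) → ℝ≥0∞} (t : ℝ), Measurable k →
        Measurable fun y : Fin n → ℝ => k (Fin.cons t y) := fun t hk =>
      hk.comp (hcons.comp measurable_prodMk_left)
    rw [split hf, split hg, split hh]
    refine prekopaLeindler_real (meas hf) (meas hg) (meas hh) fun s t => ?_
    refine prekopaLeindler_pi (fib s hf) (fib t hg) (fib _ hh) fun x y => ?_
    convert H (Fin.cons s x) (Fin.cons t y) using 3
    ext i
    refine Fin.cases ?_ (fun i => ?_) i <;> simp <;> ring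

theorem prekopaLeindler_euclidean {n : ℕ} {f g h : EuclideanSpace ℝ (Fin n) → ℝ≥0∞}
    (hf : Measurable f) (hg : Measurable g) (hh : Measurable h)
    (H : ∀ x y, f x * g y ≤ h ((1 / 2 : ℝ) • (x + y)) ^ 2) :
    (∫⁻ x, f x) * ∫⁻ x, g x ≤ (∫⁻ x, h x) ^ 2 := by
  have mp := PiLp.volume_preserving_toLp (Fin n)
  rw [← mp.lintegral_comp hf, ← mp.lintegral_comp hg, ← mp.lintegral_comp hh]
  exact prekopaLeindler_pi (hf.comp mp.measurable) (hg.comp mp.measurable)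
    (hh.comp mp.measurable) fun x y => H _ _

lemma setIntegral_exp_neg_translate_le {n : ℕ} {K : Set (Euc n)} (hK : IsCompact K)
    (hKc : Convex ℝ K) (hKsym : K = -K) {V : Euc n → ℝ} (hV : Continuous V)
    (hVconv : ConvexOn ℝ Set.univ V) (hVeven : ∀ x, V (-x) = V x) (v : Euc n) :
    ∫ x in K, Real.exp (-V (x + v)) ≤ ∫ x in K, Real.exp (-V x) := by
  have hKm := hK.measurableSet
  have hmem : ∀ x, -x ∈ K ↔ x ∈ K := fun x => by
    conv_rhs => rw [hKsym]
    rfl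
  have hint : ∀ w : Euc n, IntegrableOn (fun x => Real.exp (-V (x + w))) K := fun w =>
    (by fun_prop : Continuous fun x => Real.exp (-V (x + w))).continuousOn.integrableOn_compact hK
  let F : Euc n → Euc n → ℝ≥0∞ := fun w =>
    K.indicator fun x => ENNReal.ofReal (Real.exp (-V (x + w)))
  have hFm : ∀ w, Measurable (F w) := fun w =>
    Measurable.indicator (by fun_prop) hKm
  have hF : ∀ w, ∫⁻ x, F w x = ENNReal.ofReal (∫ x in K, Real.exp (-V (x + w))) := fun w => by
    rw [lintegral_indicator hKm,
      ofReal_integral_eq_lintegral_ofReal (hint w) (.of_forall fun x => (Real.exp_pos _).le)]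
  have hFneg : ∫⁻ x, F (-v) x = ∫⁻ x, F v x := by
    rw [← (Measure.measurePreserving_neg (volume : Measure (Euc n))).lintegral_comp (hFm (-v))]
    congr with x
    have hadd : V (-x + -v) = V (x + v) := by rw [← neg_add, hVeven]
    by_cases hx : x ∈ K <;> simp [F, hx, hmem, hadd]
  have key := prekopaLeindler_euclidean (hFm v) (hFm (-v)) (hFm 0) (fun x y => by
    by_cases hx : x ∈ K
    swap
    · simp [F, hx]
    by_cases hy : y ∈ K
    swap
    · simp [F, hy]
    have hxy : (1 / 2 : ℝ) • (x + y) ∈ K := by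
      rw [smul_add]
      exact hKc hx hy (by norm_num) (by norm_num) (by norm_num)
    simp only [F, Set.indicator_of_mem hx, Set.indicator_of_mem hy, Set.indicator_of_mem hxy]
    rw [← ENNReal.ofReal_mul (Real.exp_pos _).le, ← ENNReal.ofReal_pow (Real.exp_pos _).le,
      ← Real.exp_add, ← Real.exp_nat_mul]
    refine ENNReal.ofReal_le_ofReal (Real.exp_le_exp.2 ?_)
    have := hVconv.2 (Set.mem_univ (x + v)) (Set.mem_univ (y + -v))
      (show (0 : ℝ) ≤ 1 / 2 by norm_num) (show (0 : ℝ) ≤ 1 / 2 by norm_num)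
      (by norm_num)
    rw [← smul_add, show x + v + (y + -v) = x + y by abel] at this
    simp only [smul_eq_mul] at this
    rw [add_zero]
    push_cast
    linarith)
  rw [hFneg, ← sq, ENNReal.pow_le_pow_left_iff two_ne_zero, hF, hF,
    ENNReal.ofReal_le_ofReal_iff (integral_nonneg fun x => (Real.exp_pos _).le)] at key
  simpa using key

lemma mul_sq_le_second_difference {φ φ' φ'' : ℝ → ℝ} {m δ : ℝ} (hδ : 0 < δ)
    (h1 : ∀ t, HasDerivAt φ (φ' t) t) (h2 : ∀ t, HasDerivAt φ' (φ'' t) t)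
    (hm : ∀ t ∈ Set.Icc (-δ) δ, m ≤ φ'' t) :
    m * δ ^ 2 ≤ φ δ + φ (-δ) - 2 * φ 0 := by
  have hc : ConvexOn ℝ (Set.Icc (-δ) δ) fun t => φ t - m * t ^ 2 / 2 := by
    have d1 : ∀ t, HasDerivAt (fun t => φ t - m * t ^ 2 / 2) (φ' t - m * t) t := fun t => by
      refine ((h1 t).fun_sub (((hasDerivAt_pow 2 t).const_mul m).div_const 2)).congr_deriv ?_
      push_cast; ring
    have d2 : ∀ t, HasDerivAt (fun t => φ' t - m * t) (φ'' t - m) t := fun t => by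
      simpa using (h2 t).fun_sub ((hasDerivAt_id t).const_mul m)
    have e1 : deriv (fun t => φ t - m * t ^ 2 / 2) = fun t => φ' t - m * t :=
      funext fun t => (d1 t).deriv
    refine convexOn_of_deriv2_nonneg' (convex_Icc _ _)
      (fun t _ => (d1 t).differentiableAt.differentiableWithinAt)
      (fun t _ => by rw [e1]; exact (d2 t).differentiableAt.differentiableWithinAt)
      (fun t ht => ?_)
    simp only [Function.iterate_succ, Function.iterate_zero, Function.comp_apply, id_eq]
    rw [e1, (d2 t).deriv]
    linarith [hm t ht]
  have := hc.2 (Set.left_mem_Icc.2 (by linarith)) (Set.right_mem_Icc.2 (by linarith))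
    (show (0 : ℝ) ≤ 1 / 2 by norm_num) (show (0 : ℝ) ≤ 1 / 2 by norm_num)
      (by norm_num)
  simp only [smul_eq_mul] at this
  rw [show (1 / 2 : ℝ) * -δ + 1 / 2 * δ = 0 by ring] at this
  nlinarith

lemma hasDerivAt_comp_line {E F : Type*} [NormedAddCommGroup E] [NormedSpace ℝ E]
    [NormedAddCommGroup F] [NormedSpace ℝ F] {g : E → F} (hg : Differentiable ℝ g) (x e : E)
    (t : ℝ) : HasDerivAt (fun t : ℝ => g (x + t • e)) (fderiv ℝ g (x + t • e) e) t := by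
  have h : HasDerivAt (fun t : ℝ => x + t • e) e t := by
    simpa using ((hasDerivAt_id t).smul_const e).const_add x
  exact (hg _).hasFDerivAt.comp_hasDerivAt t h

lemma setIntegral_fderiv_fderiv_nonpos {n : ℕ} {K : Set (Euc n)} (hK : IsCompact K)
    {g : Euc n → ℝ} (hg : ContDiff ℝ 2 g) (e : Euc n)
    (hmax : ∀ t : ℝ, ∫ x in K, g (x + t • e) ≤ ∫ x in K, g x) :
    ∫ x in K, fderiv ℝ (fderiv ℝ g) x e e ≤ 0 := by
  have hg1 : ContDiff ℝ 1 (fderiv ℝ g) := hg.fderiv_right (by norm_num)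
  have hg2 : Continuous (fderiv ℝ (fderiv ℝ g)) := hg1.continuous_fderiv one_ne_zero
  have hgc := hg.continuous
  set D : Euc n → ℝ := fun x => fderiv ℝ (fderiv ℝ g) x e e with hD
  have hDc : Continuous D := by fun_prop
  have hI : ∀ {k : Euc n → ℝ}, Continuous k → IntegrableOn k K := fun hk =>
    hk.continuousOn.integrableOn_compact hK
  have hsmall : ∀ ε > 0, ∫ x in K, D x ≤ ε * volume.real K := by
    intro ε hε
    have hopen : IsOpen {p : Euc n × ℝ | D p.1 - ε < D (p.1 + p.2 • e)} :=
      isOpen_lt (by fun_prop) (by fun_prop)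
    obtain ⟨U, W, -, hW, hKU, h0W, hUW⟩ := generalized_tube_lemma hK
      (isCompact_singleton (x := (0 : ℝ))) hopen (by
        rintro ⟨x, t⟩ ⟨-, ht⟩
        obtain rfl : t = 0 := ht
        simpa using hε)
    obtain ⟨δ, hδ, hδW⟩ := Metric.isOpen_iff.1 hW 0 (h0W rfl)
    have hpt : ∀ x ∈ K, (D x - ε) * (δ / 2) ^ 2
        ≤ g (x + (δ / 2) • e) + g (x + (-(δ / 2)) • e) - 2 * g x := by
      intro x hx
      have := mul_sq_le_second_difference (φ := fun t => g (x + t • e))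
        (φ' := fun t => fderiv ℝ g (x + t • e) e) (φ'' := fun t => D (x + t • e))
        (m := D x - ε) (half_pos hδ) (hasDerivAt_comp_line (hg.differentiable two_ne_zero) x e)
        (fun t => by
          simpa using (hasDerivAt_comp_line (hg1.differentiable one_ne_zero) x e t).clm_apply
            (hasDerivAt_const t e))
        (fun t ht => by
          refine (hUW (Set.mk_mem_prod (hKU hx) (hδW ?_)) : D x - ε < D (x + t • e)).le
          rw [mem_ball_zero_iff, Real.norm_eq_abs, abs_lt]
          constructor <;> linarith [ht.1, ht.2])
      simpa using this
    have hint := setIntegral_mono_on (μ := volume) (hI (by fun_prop)) (hI (by fun_prop))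
      hK.measurableSet hpt
    rw [integral_mul_const, integral_sub (hI hDc) (hI continuous_const), setIntegral_const,
      integral_sub (hI (by fun_prop)) (hI (by fun_prop)),
      integral_add (hI (by fun_prop)) (hI (by fun_prop)), integral_const_mul, smul_eq_mul] at hint
    have h1 := hmax (δ / 2)
    have h2 := hmax (-(δ / 2))
    have h3 : (0 : ℝ) < (δ / 2) ^ 2 := by positivity
    by_contra! hcon
    nlinarith [mul_pos (sub_pos.2 hcon) h3]
  refine le_of_forall_pos_le_add fun ε hε => ?_
  refine (hsmall (ε / (volume.real K + 1)) (by positivity)).trans ?_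
  rw [zero_add, div_mul_eq_mul_div, div_le_iff₀ (by positivity)]
  nlinarith [measureReal_nonneg (μ := (volume : Measure (Euc n))) (s := K)]

lemma fderiv_fderiv_exp_neg {E : Type*} [NormedAddCommGroup E] [NormedSpace ℝ E]
    {V : E → ℝ} (hV : ContDiff ℝ 2 V) (x e : E) :
    fderiv ℝ (fderiv ℝ fun y => Real.exp (-V y)) x e e
      = Real.exp (-V x) * ((fderiv ℝ V x e) ^ 2 - fderiv ℝ (fderiv ℝ V) x e e) := by
  have hV0 : Differentiable ℝ V := hV.differentiable two_ne_zero
  have hV1 : Differentiable ℝ (fderiv ℝ V) :=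
    (hV.fderiv_right (m := 1) (by norm_num)).differentiable one_ne_zero
  have h1 : ∀ y, HasFDerivAt (fun y => Real.exp (-V y)) (Real.exp (-V y) • -fderiv ℝ V y) y :=
    fun y => (hV0 y).hasFDerivAt.neg.exp
  have e1 : fderiv ℝ (fun y => Real.exp (-V y)) = fun y => Real.exp (-V y) • -fderiv ℝ V y :=
    funext fun y => (h1 y).fderiv
  rw [e1, ((h1 x).fun_smul (hV1 x).hasFDerivAt.fun_neg).fderiv]
  simp
  ring

/-- The Brascamp–Lieb inequality on a symmetric convex body for the odd function `∂ₑV`. -/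
lemma setIntegral_sq_fderiv_le {n : ℕ} {K : Set (Euc n)} (hK : IsCompact K)
    (hKc : Convex ℝ K) (hKsym : K = -K) {V : Euc n → ℝ} (hV : ContDiff ℝ 2 V)
    (hVconv : ConvexOn ℝ Set.univ V) (hVeven : ∀ x, V (-x) = V x) (e : Euc n) :
    ∫ x in K, Real.exp (-V x) * (fderiv ℝ V x e) ^ 2
      ≤ ∫ x in K, Real.exp (-V x) * fderiv ℝ (fderiv ℝ V) x e e := by
  have hVc := hV.continuous
  have hV1 : ContDiff ℝ 1 (fderiv ℝ V) := hV.fderiv_right (by norm_num)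
  have hV1c := hV1.continuous
  have hV2 : Continuous (fderiv ℝ (fderiv ℝ V)) := hV1.continuous_fderiv one_ne_zero
  have hI : ∀ {k : Euc n → ℝ}, Continuous k → IntegrableOn k K := fun hk =>
    hk.continuousOn.integrableOn_compact hK
  have key := setIntegral_fderiv_fderiv_nonpos hK (g := fun y => Real.exp (-V y))
    (Real.contDiff_exp.comp hV.neg) e
    (fun t => setIntegral_exp_neg_translate_le hK hKc hKsym hVc hVconv hVeven (t • e))
  simp only [fderiv_fderiv_exp_neg hV, mul_sub] at key
  rw [integral_sub (hI (by fun_prop)) (hI (by fun_prop))] at key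
  linarith

lemma norm_gradient_sq {n : ℕ} (f : Euc n → ℝ) (x : Euc n) :
    ‖gradient f x‖ ^ 2 = ∑ i, (fderiv ℝ f x (EuclideanSpace.single i 1)) ^ 2 := by
  rw [EuclideanSpace.real_norm_sq_eq]
  refine Finset.sum_congr rfl fun i _ => ?_
  rw [← inner_gradient_left, EuclideanSpace.inner_single_right]
  simp

lemma continuous_hess_apply {n : ℕ} {f : Euc n → ℝ} (hf : ContDiff ℝ 2 f) (v w : Euc n) :
    Continuous fun x => fderiv ℝ (fderiv ℝ f) x v w := by
  have : Continuous (fderiv ℝ (fderiv ℝ f)) :=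
    (hf.fderiv_right (m := 1) (by norm_num)).continuous_fderiv one_ne_zero
  fun_prop

lemma lapl_eq {n : ℕ} (f : Euc n → ℝ) (x : Euc n) :
    lapl f x = ∑ i, fderiv ℝ (fderiv ℝ f) x (EuclideanSpace.single i 1)
      (EuclideanSpace.single i 1) := by
  simp [lapl, iteratedFDeriv_two_apply]

lemma hessHS2_eq {n : ℕ} (f : Euc n → ℝ) (x : Euc n) :
    hessHS2 f x = ∑ i, ∑ j, (fderiv ℝ (fderiv ℝ f) x (EuclideanSpace.single i 1)
      (EuclideanSpace.single j 1)) ^ 2 := by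
  simp [hessHS2, iteratedFDeriv_two_apply]

lemma continuous_norm_gradient_sq {n : ℕ} {f : Euc n → ℝ} (hf : ContDiff ℝ 1 f) :
    Continuous fun x => ‖gradient f x‖ ^ 2 := by
  have := hf.continuous_fderiv one_ne_zero
  simp only [norm_gradient_sq]
  fun_prop

lemma continuous_lapl {n : ℕ} {f : Euc n → ℝ} (hf : ContDiff ℝ 2 f) : Continuous (lapl f) := by
  rw [funext (lapl_eq f)]
  exact continuous_finsetSum _ fun i _ => continuous_hess_apply hf _ _

lemma continuous_hessHS2 {n : ℕ} {f : Euc n → ℝ} (hf : ContDiff ℝ 2 f) :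
    Continuous (hessHS2 f) := by
  rw [funext (hessHS2_eq f)]
  exact continuous_finsetSum _ fun i _ => continuous_finsetSum _ fun j _ =>
    (continuous_hess_apply hf _ _).pow 2

lemma fderiv_apply_neg_of_even {E : Type*} [NormedAddCommGroup E] [NormedSpace ℝ E]
    {f : E → ℝ} (hf : ∀ x, f (-x) = f x) (x e : E) :
    fderiv ℝ f (-x) e = -fderiv ℝ f x e := by
  have h := fderiv_comp_smul (𝕜 := ℝ) (f := f) (x := x) (-1 : ℝ)
  simp only [neg_smul, one_smul, hf] at h
  simp [h]

lemma two_mul_le_of_lapl_sub_inner_eq_one {n : ℕ} (u V : Euc n → ℝ) (x : Euc n) (N : ℝ)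
    (h : lapl u x - ⟪gradient u x, gradient V x⟫ = 1) :
    2 * N ≤ N ^ 2 * (hessHS2 u x + ‖gradient u x‖ ^ 2) + n + ‖gradient V x‖ ^ 2 := by
  have h1 : 2 * N * lapl u x ≤ N ^ 2 * hessHS2 u x + n := by
    rw [lapl_eq, hessHS2_eq, Finset.mul_sum, Finset.mul_sum,
      show (n : ℝ) = ∑ _i : Fin n, (1 : ℝ) by simp, ← Finset.sum_add_distrib]
    refine Finset.sum_le_sum fun i _ => ?_
    set H := fun i j => fderiv ℝ (fderiv ℝ u) x (EuclideanSpace.single i 1)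
      (EuclideanSpace.single j 1)
    have h2 : H i i ^ 2 ≤ ∑ j, H i j ^ 2 :=
      Finset.single_le_sum (f := fun j => H i j ^ 2) (fun j _ => sq_nonneg _) (Finset.mem_univ i)
    have h3 := mul_le_mul_of_nonneg_left h2 (sq_nonneg N)
    have : 2 * N * H i i ≤ N ^ 2 * ∑ j, H i j ^ 2 + 1 := by nlinarith [sq_nonneg (N * H i i - 1)]
    exact this
  have h2 := norm_add_sq_real (N • gradient u x) (gradient V x)
  rw [norm_smul, mul_pow, Real.norm_eq_abs, sq_abs, real_inner_smul_left] at h2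
  have h3 := sq_nonneg ‖N • gradient u x + gradient V x‖
  have h4 : 2 * N = 2 * N * lapl u x - 2 * N * ⟪gradient u x, gradient V x⟫ := by
    rw [← mul_sub, h, mul_one]
  linarith

section Weighted

variable {n : ℕ} {K : Set (Euc n)} {V : Euc n → ℝ} {μ : Measure (Euc n)}

lemma setIntegral_eq_of_density (hK : MeasurableSet K) (hV : Continuous V)
    (hμ : μ = volume.withDensity fun x => ENNReal.ofReal (Real.exp (-V x))) (f : Euc n → ℝ) :
    ∫ x in K, f x ∂μ = ∫ x in K, Real.exp (-V x) * f x := by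
  rw [hμ, setIntegral_withDensity_eq_setIntegral_toReal_smul (by fun_prop)
    (.of_forall fun x => ENNReal.ofReal_lt_top) _ hK]
  simp [ENNReal.toReal_ofReal (Real.exp_pos _).le]

lemma setIntegral_eq_zero_of_odd (hK : MeasurableSet K) (hKsym : K = -K) (hV : Continuous V)
    (hVeven : ∀ x, V (-x) = V x)
    (hμ : μ = volume.withDensity fun x => ENNReal.ofReal (Real.exp (-V x)))
    {f : Euc n → ℝ} (hf : ∀ x, f (-x) = -f x) : ∫ x in K, f x ∂μ = 0 := by
  rw [setIntegral_eq_of_density hK hV hμ, ← integral_indicator hK]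
  set F := K.indicator fun x => Real.exp (-V x) * f x with hF
  have hodd : ∀ x, F (-x) = -F x := fun x => by
    have hmem : -x ∈ K ↔ x ∈ K := by
      conv_rhs => rw [hKsym]
      rfl
    by_cases hx : x ∈ K <;> simp [hF, hx, hmem, hVeven, hf]
  have h := integral_neg_eq_self F volume
  simp only [hodd, integral_neg] at h
  linarith

lemma setIntegral_norm_gradient_sq_le_lapl (hK : IsCompact K) (hKc : Convex ℝ K)
    (hKsym : K = -K) (hV : ContDiff ℝ 2 V) (hVconv : ConvexOn ℝ Set.univ V)
    (hVeven : ∀ x, V (-x) = V x)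
    (hμ : μ = volume.withDensity fun x => ENNReal.ofReal (Real.exp (-V x))) :
    ∫ x in K, ‖gradient V x‖ ^ 2 ∂μ ≤ ∫ x in K, lapl V x ∂μ := by
  have hVc := hV.continuous
  have hV1 : Continuous (fderiv ℝ V) := hV.continuous_fderiv two_ne_zero
  have hI : ∀ {k : Euc n → ℝ}, Continuous k → IntegrableOn k K := fun hk =>
    hk.continuousOn.integrableOn_compact hK
  simp only [setIntegral_eq_of_density hK.measurableSet hVc hμ, norm_gradient_sq, lapl_eq,
    Finset.mul_sum]
  rw [integral_finsetSum _ fun i _ => hI (by fun_prop),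
    integral_finsetSum _ fun i _ => hI (by have := continuous_hess_apply hV; fun_prop)]
  exact Finset.sum_le_sum fun i _ =>
    setIntegral_sq_fderiv_le hK hKc hKsym hV hVconv hVeven _

lemma setIntegral_norm_gradient_sq_le_hessHS2 [IsFiniteMeasureOnCompacts μ] (hK : IsCompact K)
    (hKsym : K = -K) (hV : Continuous V) (hVeven : ∀ x, V (-x) = V x)
    (hμ : μ = volume.withDensity fun x => ENNReal.ofReal (Real.exp (-V x)))
    {C : ℝ} (hpoin : PoincareHolds μ K C) {u : Euc n → ℝ} (hu : ContDiff ℝ 2 u)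
    (hueven : ∀ x, u (-x) = u x) :
    (μ K).toReal⁻¹ * ∫ x in K, ‖gradient u x‖ ^ 2 ∂μ
      ≤ C ^ 2 * ((μ K).toReal⁻¹ * ∫ x in K, hessHS2 u x ∂μ) := by
  have hu1 : ContDiff ℝ 1 (fderiv ℝ u) := hu.fderiv_right (by norm_num)
  have hu1c := hu1.continuous
  have hu2 := continuous_hess_apply hu
  have hI : ∀ {k : Euc n → ℝ}, Continuous k → IntegrableOn k K μ := fun hk =>
    hk.continuousOn.integrableOn_compact hK
  have hpart : ∀ i : Fin n,
      (μ K).toReal⁻¹ * ∫ x in K, (fderiv ℝ u x (EuclideanSpace.single i 1)) ^ 2 ∂μ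
      ≤ C ^ 2 * ((μ K).toReal⁻¹ * ∑ j, ∫ x in K, (fderiv ℝ (fderiv ℝ u) x
        (EuclideanSpace.single j 1) (EuclideanSpace.single i 1)) ^ 2 ∂μ) := by
    intro i
    have h := hpoin (fun x => fderiv ℝ u x (EuclideanSpace.single i 1)) (by fun_prop)
    rw [setIntegral_eq_zero_of_odd (f := fun x => fderiv ℝ u x (EuclideanSpace.single i 1))
      hK.measurableSet hKsym hV hVeven hμ (fun x => fderiv_apply_neg_of_even hueven x _)] at h
    have hd : ∀ x v, fderiv ℝ (fun x => fderiv ℝ u x (EuclideanSpace.single i 1)) x v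
        = fderiv ℝ (fderiv ℝ u) x v (EuclideanSpace.single i 1) := fun x v => by
      rw [fderiv_clm_apply (hu1.differentiable one_ne_zero x) (by fun_prop)]
      simp
    simp only [norm_gradient_sq, hd] at h
    rw [integral_finsetSum _ fun j _ => hI (by fun_prop)] at h
    simpa using h
  simp only [norm_gradient_sq, hessHS2_eq]
  rw [integral_finsetSum _ fun i _ => hI (by fun_prop),
    integral_finsetSum _ fun i _ => hI (by fun_prop), Finset.mul_sum]
  refine (Finset.sum_le_sum fun i _ => hpart i).trans_eq ?_
  rw [← Finset.mul_sum, ← Finset.mul_sum, Finset.sum_comm]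
  congr 3
  funext i
  exact (integral_finsetSum _ fun j _ => hI (by fun_prop)).symm

end Weighted

/-- Lemma 6.3: if `u` is even, `C²`, `Lu = 1` on `K`, and `aC⁻² + b ≥ 0`, `a ≥ b`, then
`⨍_K (a‖∇²u‖² + b|∇u|²) dμ ≥ (aC⁻² + b)/((1 + C⁻²)(1 + k₂)n)`, where `C` is the
Poincaré constant of `μ` restricted to `K`. -/
theorem avg_hessian_grad_lower_bound (n : ℕ) (hn : 1 ≤ n)
    (K : Set (Euc n)) (hK : IsConvexBody K) (hKsym : K = -K)
    (V : Euc n → ℝ) (hV : ContDiff ℝ 2 V) (hVconv : ConvexOn ℝ Set.univ V)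
    (hVeven : ∀ x, V (-x) = V x)
    (μ : Measure (Euc n))
    (hμ : μ = volume.withDensity fun x => ENNReal.ofReal (Real.exp (-V x)))
    (k₂ : ℝ) (hk₂ : 0 ≤ k₂)
    (hlapV : ∫ x in K, lapl V x ∂μ ≤ k₂ * n * (μ K).toReal)
    (C : ℝ) (hC : 0 < C)
    (hpoin : PoincareHolds μ K C)
    (hCmin : ∀ C' : ℝ, 0 ≤ C' → PoincareHolds μ K C' → C ≤ C')
    (u : Euc n → ℝ) (hu : ContDiff ℝ 2 u) (hueven : ∀ x, u (-x) = u x)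
    (hLu : ∀ x ∈ K, lapl u x - ⟪gradient u x, gradient V x⟫ = 1)
    (a b : ℝ) (hab : a * (C ^ 2)⁻¹ + b ≥ 0) (hba : b ≤ a) :
    (a * (C ^ 2)⁻¹ + b) / ((1 + (C ^ 2)⁻¹) * (1 + k₂) * n)
      ≤ (μ K).toReal⁻¹ *
          ∫ x in K, (a * hessHS2 u x + b * ‖gradient u x‖ ^ 2) ∂μ := by
  obtain ⟨hKcpt, hKconv, hKint⟩ := hK
  have hVc := hV.continuous
  have hfin : IsLocallyFiniteMeasure μ :=
    hμ ▸ IsLocallyFiniteMeasure.withDensity_ofReal (by fun_prop)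
  have hI : ∀ {k : Euc n → ℝ}, Continuous k → IntegrableOn k K μ := fun hk =>
    hk.continuousOn.integrableOn_compact hKcpt
  have hμK : 0 < (μ K).toReal := by
    refine ENNReal.toReal_pos ?_ hKcpt.measure_lt_top.ne
    have hac : volume ≪ μ := hμ ▸ withDensity_absolutelyContinuous' (by fun_prop)
      (.of_forall fun x => by simp [Real.exp_pos])
    exact fun h => (Measure.measure_pos_of_nonempty_interior volume hKint).ne' (hac h)
  have hn0 : (0 : ℝ) < n := by exact_mod_cast hn
  set m := (μ K).toReal with hm
  set X := m⁻¹ * ∫ x in K, hessHS2 u x ∂μ with hX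
  set Y := m⁻¹ * ∫ x in K, ‖gradient u x‖ ^ 2 ∂μ with hY
  set Z := ∫ x in K, ‖gradient V x‖ ^ 2 ∂μ with hZ
  have cH := continuous_hessHS2 hu
  have cu := continuous_norm_gradient_sq (hu.of_le one_le_two)
  have cV := continuous_norm_gradient_sq (hV.of_le one_le_two)
  have hYX : Y ≤ C ^ 2 * X := setIntegral_norm_gradient_sq_le_hessHS2 hKcpt hKsym hVc hVeven hμ
    hpoin hu hueven
  have hZle : Z ≤ k₂ * n * m := (setIntegral_norm_gradient_sq_le_lapl hKcpt hKconv hKsym hV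
    hVconv hVeven hμ).trans hlapV
  set N : ℝ := (1 + k₂) * n with hN
  have hN0 : 0 < N := by positivity
  have hXY : 1 ≤ N * (X + Y) := by
    have h := setIntegral_mono_on (μ := μ) (hI continuous_const) (hI (by fun_prop))
      hKcpt.measurableSet
      fun x hx => two_mul_le_of_lapl_sub_inner_eq_one u V x N (hLu x hx)
    rw [integral_add (hI (by fun_prop)) (hI cV), integral_add (hI (by fun_prop)) (hI (by fun_prop)),
      integral_const_mul (N ^ 2), integral_add (hI cH) (hI cu), setIntegral_const, setIntegral_const,
      measureReal_def, ← hm, ← hZ, smul_eq_mul, smul_eq_mul] at h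
    have h1 : ∫ x in K, hessHS2 u x ∂μ = m * X := by rw [hX]; field_simp
    have h2 : ∫ x in K, ‖gradient u x‖ ^ 2 ∂μ = m * Y := by rw [hY]; field_simp
    rw [h1, h2] at h
    have h3 : (m * N) * 1 ≤ (m * N) * (N * (X + Y)) := by
      have : m * N = m * n + k₂ * n * m := by rw [hN]; ring
      linarith
    exact le_of_mul_le_mul_left h3 (by positivity)
  have hC2 : 0 < C ^ 2 := by positivity
  rw [integral_add (hI (by fun_prop)) (hI (by fun_prop)), integral_const_mul, integral_const_mul,
    show m⁻¹ * (a * ∫ x in K, hessHS2 u x ∂μ + b * ∫ x in K, ‖gradient u x‖ ^ 2 ∂μ)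
      = a * X + b * Y by rw [hX, hY]; ring]
  set c := (C ^ 2)⁻¹ with hc
  have hc0 : 0 < c := by positivity
  have hcY : c * Y ≤ X := by
    rw [hc, inv_mul_le_iff₀ hC2]
    exact hYX
  rw [mul_assoc, ← hN, div_le_iff₀ (by positivity)]
  nlinarith [mul_le_mul_of_nonneg_left hXY hab,
    mul_nonneg (mul_nonneg (sub_nonneg.2 hba) (sub_nonneg.2 hcY)) hN0.le]

end
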